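/- Let f ∈ F_2[t] be an irreducible polynomial with f ≠ t and f ≠ t+1 that is not self-reciprocal, and let R_f = F_2[t, t^{-1}, f(t)^{-1}]. Let φ be an automorphism of the additive group (R_f,+) and let Φ be an automorphism of the multiplicative group U(R_f). Then: (i) if Φ(u)·φ(1) = φ(u) for all u ∈ U(R_f), then Φ(u) = u for all u ∈ U(R_f); (ii) if Φ(u)·φ(1) = φ(u^{-1}) for all u ∈ U(R_f), then Φ(u) = u^{-1} for all u ∈ U(R_f). -/

import Mathlib

open Polynomial IntermediateField

lemma aux_monic {p : (ZMod 2)[X]} (hp : p ≠ 0) : p.Monic := by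
  have h : p.leadingCoeff ≠ 0 := leadingCoeff_ne_zero.mpr hp
  have key : ∀ a : ZMod 2, a ≠ 0 → a = 1 := by decide
  exact key _ h

lemma aux_assoc {p q : (ZMod 2)[X]} (hp : p ≠ 0) (hq : q ≠ 0) (h : Associated p q) : p = q :=
  eq_of_monic_of_associated (aux_monic hp) (aux_monic hq) h

lemma aux_eval0 {f : (ZMod 2)[X]} (hirr : Irreducible f) (hft : f ≠ X) : f.coeff 0 ≠ 0 := by
  intro h
  have h1 : (X : (ZMod 2)[X]) ∣ f := X_dvd_iff.mpr h
  exact hft (aux_assoc hirr.ne_zero X_ne_zero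
    ((irreducible_X.dvd_irreducible_iff_associated hirr).mp h1).symm)

lemma aux_eval1 {f : (ZMod 2)[X]} (hirr : Irreducible f) (hft : f ≠ X + 1) : f.eval 1 = 1 := by
  have key : ∀ a : ZMod 2, a ≠ 0 → a = 1 := by decide
  apply key
  intro h
  have h1 : (X - C 1 : (ZMod 2)[X]) ∣ f := dvd_iff_isRoot.mpr h
  have h2 := aux_assoc hirr.ne_zero (X_sub_C_ne_zero (1 : ZMod 2))
    (((irreducible_X_sub_C (1 : ZMod 2)).dvd_irreducible_iff_associated hirr).mp h1).symm
  apply hft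
  rw [h2, sub_eq_add_neg, ← C_neg]
  rw [show (-1 : ZMod 2) = 1 by decide, C_1]

lemma aux_lin {p : (ZMod 2)[X]} (hp : p ≠ 0) (h : p.natDegree ≤ 1) :
    p = 1 ∨ p = X ∨ p.eval 1 = 0 := by
  obtain ⟨a, b, rfl⟩ := exists_eq_X_add_C_of_natDegree_le_one h
  have key : ∀ a : ZMod 2, a = 0 ∨ a = 1 := by decide
  rcases key a with rfl | rfl <;> rcases key b with rfl | rfl
  · simp at hp
  · simp
  · simp
  · right; right
    simp; decide

section
variable {f : (ZMod 2)[X]} {R : Type*} [CommRing R] [Algebra (ZMod 2)[X] R]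

lemma aux_span [IsLocalization (Submonoid.closure {X, f}) R] (x : R) :
    x ∈ AddSubmonoid.closure (Set.range (Units.val : Rˣ → R)) := by
  have hX : IsUnit (algebraMap (ZMod 2)[X] R X) :=
    IsLocalization.map_units R (⟨X, Submonoid.subset_closure (by simp)⟩ :
      (Submonoid.closure {X, f} : Submonoid (ZMod 2)[X]))
  obtain ⟨p, s, rfl⟩ := IsLocalization.exists_mk'_eq (Submonoid.closure {X, f}) x
  obtain ⟨v, hv⟩ := IsLocalization.map_units R s
  have hs : IsLocalization.mk' R p s = algebraMap _ R p * (v⁻¹ : Rˣ) := by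
    rw [IsLocalization.mk'_eq_iff_eq_mul, ← hv, mul_assoc]
    simp
  rw [hs]
  induction p using Polynomial.induction_on' with
  | add p q hp hq =>
    rw [map_add, add_mul]
    exact add_mem (hp (by rw [IsLocalization.mk'_eq_iff_eq_mul, ← hv, mul_assoc]; simp))
      (hq (by rw [IsLocalization.mk'_eq_iff_eq_mul, ← hv, mul_assoc]; simp))
  | monomial n a =>
    have key : ∀ a : ZMod 2, a = 0 ∨ a = 1 := by decide
    rcases key a with rfl | rfl
    · simp
    · rw [monomial_one_right_eq_X_pow, map_pow]
      obtain ⟨w, hw⟩ := hX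
      apply AddSubmonoid.subset_closure
      exact ⟨w ^ n * v⁻¹, by simp [hw]⟩

/-- the induced ring automorphism -/
lemma aux_ring [IsLocalization (Submonoid.closure {X, f}) R] (φ : R ≃+ R) (Φ : Rˣ ≃* Rˣ)
    (h : ∀ u : Rˣ, (Φ u : R) * φ 1 = φ u) :
    ∃ ψ : R →+* R, Function.Surjective ψ ∧ ∀ u : Rˣ, ψ u = Φ u := by
  have h1 : ∀ x, ∃ y, φ x = φ 1 * y := by
    intro x
    induction aux_span (f := f) x using AddSubmonoid.closure_induction with
    | mem x hx => obtain ⟨u, rfl⟩ := hx; exact ⟨Φ u, by rw [← h, mul_comm]⟩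
    | zero => exact ⟨0, by simp⟩
    | add x y _ _ hx hy =>
      obtain ⟨a, ha⟩ := hx
      obtain ⟨b, hb⟩ := hy
      exact ⟨a + b, by rw [map_add, ha, hb, mul_add]⟩
  obtain ⟨d, hd⟩ : ∃ d, φ 1 * d = 1 := by
    obtain ⟨x, hx⟩ := φ.surjective 1
    obtain ⟨y, hy⟩ := h1 x
    exact ⟨y, by rw [← hy, hx]⟩
  have hu : ∀ u : Rˣ, d * φ u = Φ u := by
    intro u
    rw [← h, mul_comm, mul_assoc, hd, mul_one]
  have hmul : ∀ x y, d * φ (x * y) = (d * φ x) * (d * φ y) := by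
    intro x y
    induction aux_span (f := f) x using AddSubmonoid.closure_induction with
    | mem x hx =>
      obtain ⟨u, rfl⟩ := hx
      induction aux_span (f := f) y using AddSubmonoid.closure_induction with
      | mem y hy =>
        obtain ⟨v, rfl⟩ := hy
        rw [← Units.val_mul, hu, hu, hu, map_mul, Units.val_mul]
      | zero => simp
      | add x y _ _ hx hy => rw [mul_add, map_add, mul_add, hx, hy, map_add]; ring
    | zero => simp
    | add a b _ _ hx hy => rw [add_mul, map_add, mul_add, hx, hy, map_add]; ring
  refine ⟨{ toFun := fun x => d * φ x, map_one' := by rw [mul_comm, hd],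
            map_zero' := by simp, map_add' := fun x y => by rw [map_add, mul_add],
            map_mul' := hmul }, ?_, hu⟩
  intro y
  obtain ⟨x, hx⟩ := φ.surjective (φ 1 * y)
  refine ⟨x, ?_⟩
  change d * φ x = y
  rw [hx, ← mul_assoc, mul_comm d, hd, one_mul]

lemma aux_main [IsLocalization (Submonoid.closure {X, f}) R] (hirr : Irreducible f)
    (hft : f ≠ X) (hft1 : f ≠ X + 1) (hrec : f.reverse ≠ f)
    (ψ : R →+* R) (hψ : Function.Surjective ψ) : ψ = RingHom.id R := by
  let M : Submonoid (ZMod 2)[X] := Submonoid.closure {X, f}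
  let a := algebraMap (ZMod 2)[X] R
  have hM : M ≤ nonZeroDivisors (ZMod 2)[X] := by
    apply Submonoid.closure_le.mpr
    rintro x (rfl | rfl)
    · exact mem_nonZeroDivisors_of_ne_zero X_ne_zero
    · exact mem_nonZeroDivisors_of_ne_zero hirr.ne_zero
  have hainj : Function.Injective a := IsLocalization.injective R hM
  have hXM : X ∈ M := Submonoid.subset_closure (by simp)
  have hfM : f ∈ M := Submonoid.subset_closure (by simp)
  have hX : IsUnit (a X) := IsLocalization.map_units R (⟨X, hXM⟩ : M)
  have hf : IsUnit (a f) := IsLocalization.map_units R (⟨f, hfM⟩ : M)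
  let j : R →+* RatFunc (ZMod 2) := IsLocalization.lift (M := M)
    (g := algebraMap (ZMod 2)[X] (RatFunc (ZMod 2)))
    (fun y => (RatFunc.algebraMap_ne_zero (nonZeroDivisors.ne_zero (hM y.2))).isUnit)
  have hj : ∀ p, j (a p) = algebraMap _ _ p := fun p => IsLocalization.lift_eq _ p
  have hjinj : Function.Injective j := by
    apply (IsLocalization.lift_injective_iff _).mpr
    intro x y
    rw [hainj.eq_iff, (RatFunc.algebraMap_injective (ZMod 2)).eq_iff]
  -- evaluation at 1
  have hev : ∀ y : M, IsUnit ((evalRingHom (1 : ZMod 2)) y) := by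
    rintro ⟨y, hy⟩
    have : M ≤ (IsUnit.submonoid (ZMod 2)).comap (evalRingHom (1 : ZMod 2)) := by
      apply Submonoid.closure_le.mpr
      rintro x (rfl | rfl)
      · simp [IsUnit.mem_submonoid_iff]
      · simp [IsUnit.mem_submonoid_iff, aux_eval1 hirr hft1]
    exact this hy
  let e : R →+* ZMod 2 := IsLocalization.lift (M := M) hev
  have he : ∀ p, e (a p) = p.eval 1 := fun p => IsLocalization.lift_eq _ p
  have hnu : ∀ p : (ZMod 2)[X], p.eval 1 = 0 → ¬ IsUnit (a p) := by
    intro p hp hu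
    have := hu.map e
    rw [he, hp] at this
    exact not_isUnit_zero this
  have hψa : ∀ p, j (ψ (a p)) = aeval (j (ψ (a X))) p := by
    intro p
    have : ((j.comp ψ).comp a) = (aeval (R := ZMod 2) (j (ψ (a X)))).toRingHom := by
      apply Polynomial.ringHom_ext'
      · exact Subsingleton.elim _ _
      · simp
    exact congrArg (fun g => g p) this
  set u := ψ (a X) with hudef
  have hu : IsUnit u := hX.map ψ
  have htop : (ZMod 2)⟮j u⟯ = ⊤ := by
    rw [eq_top_iff, ← RatFunc.adjoin_X, adjoin_simple_le_iff, mem_adjoin_simple_iff]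
    obtain ⟨r, hr⟩ := hψ (a X)
    obtain ⟨p, s, rfl⟩ := IsLocalization.exists_mk'_eq M r
    refine ⟨p, s, ?_⟩
    have h1 := IsLocalization.mk'_spec R p s
    have h2 := congrArg (fun x => j (ψ x)) h1
    simp only [map_mul, hr] at h2
    have h3 := hψa p
    have h4 := hψa s
    simp only [a] at h3 h4
    rw [h3, h4] at h2
    rw [eq_div_iff, ← h2]
    · congr 1
      change _ = j (a X)
      rw [hj, RatFunc.algebraMap_X]
    · rw [← h4]
      exact (((IsLocalization.map_units R s).map ψ).map j).ne_zero
  have hdeg := (j u).finrank_eq_max_natDegree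
  rw [htop, IntermediateField.finrank_top] at hdeg
  have hju : j u ≠ 0 := (hu.map j).ne_zero
  have hrel : a (j u).num = u * a (j u).denom := by
    apply hjinj
    rw [map_mul, hj, hj, ← div_eq_iff, RatFunc.num_div_denom]
    exact RatFunc.algebraMap_ne_zero (j u).denom_ne_zero
  have hn0 := RatFunc.num_ne_zero hju
  have hd0 := (j u).denom_ne_zero
  have hcop := (j u).isCoprime_num_denom
  have hna := aux_lin hn0 (by omega)
  have hda := aux_lin hd0 (by omega)
  generalize (j u).num = A at *
  generalize (j u).denom = B at *
  have hnon : ¬ (A.eval 1 = 0 ∨ B.eval 1 = 0) := by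
    intro h
    have h2 := congrArg e hrel
    rw [map_mul, he, he] at h2
    have h3 := (hu.map e).ne_zero
    have h4 : A.eval 1 = 0 ∧ B.eval 1 = 0 := by
      rcases h with h | h
      · rw [h] at h2
        exact ⟨h, (mul_eq_zero.mp h2.symm).resolve_left h3⟩
      · rw [h, mul_zero] at h2
        exact ⟨h2, h⟩
    obtain ⟨x, y, hxy⟩ := hcop
    have := congrArg (eval 1) hxy
    simp [h4.1, h4.2] at this
  have hcases : u = a X ∨ u * a X = 1 := by
    rcases hna with rfl | rfl | h
    · rcases hda with rfl | rfl | h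
      · simp at hdeg
      · right; rw [← hrel, map_one]
      · exact absurd (Or.inr h) hnon
    · rcases hda with rfl | rfl | h
      · left; rw [hrel, map_one, mul_one]
      · exact absurd (isCoprime_self.mp hcop) not_isUnit_X
      · exact absurd (Or.inr h) hnon
    · exact absurd (Or.inl h) hnon
  rcases hcases with h | h
  · apply IsLocalization.ringHom_ext M
    apply Polynomial.ringHom_ext'
    · exact Subsingleton.elim _ _
    · simpa using h
  · exfalso
    apply hrec
    have hψe : ∀ p, ψ (a p) = eval₂ (a.comp C) u p := by
      intro p
      have : ψ.comp a = eval₂RingHom (a.comp C) u := by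
        apply Polynomial.ringHom_ext'
        · exact Subsingleton.elim _ _
        · simp [hudef]
      exact congrArg (fun g => g p) this
    letI : Invertible u := ⟨a X, by rw [mul_comm, h], h⟩
    have h1 := eval₂_reverse_mul_pow (a.comp C) u f
    have h2 : eval₂ (a.comp C) (⅟u) f.reverse = a f.reverse := by
      change eval₂ (a.comp C) (a X) f.reverse = _
      rw [← hom_eval₂, eval₂_C_X]
    rw [h2, ← hψe] at h1
    have h3 : IsUnit (a f.reverse) := by
      have := hf.map ψ
      rw [← h1] at this
      exact isUnit_of_mul_isUnit_left this
    -- divides an element of M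
    have h4 : ∃ m ∈ M, f.reverse ∣ m := by
      obtain ⟨w, hw⟩ := h3.exists_right_inv
      obtain ⟨p, s, rfl⟩ := IsLocalization.exists_mk'_eq M w
      refine ⟨s, s.2, p, hainj ?_⟩
      have := IsLocalization.mk'_spec R p s
      rw [map_mul]
      change _ = _ * (algebraMap _ R p)
      rw [← this, ← mul_assoc, hw, one_mul]
    obtain ⟨m, hm, hdvd⟩ := h4
    obtain ⟨k, l, rfl⟩ := (Submonoid.mem_closure_pair _ _ _).mp hm
    have hf0 := aux_eval0 hirr hft
    have hcopX : IsCoprime f.reverse (X ^ k) := by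
      apply IsCoprime.pow_right
      apply IsCoprime.symm
      refine (irreducible_X.coprime_iff_not_dvd).mpr ?_
      rw [X_dvd_iff, coeff_zero_reverse]
      exact leadingCoeff_ne_zero.mpr hirr.ne_zero
    have h5 := hcopX.dvd_of_dvd_mul_left hdvd
    obtain ⟨i, hi, hassoc⟩ := (dvd_prime_pow hirr.prime l).mp h5
    have h6 : f.reverse = f ^ i :=
      aux_assoc (by simpa using hirr.ne_zero) (pow_ne_zero _ hirr.ne_zero) hassoc
    have h7 : f.reverse.natDegree = f.natDegree := by
      rw [reverse_natDegree, natTrailingDegree_eq_zero.mpr (Or.inr hf0), Nat.sub_zero]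
    rw [h6, natDegree_pow] at h7
    have h8 := hirr.natDegree_pos
    have : i = 1 := by nlinarith
    rw [h6, this, pow_one]

lemma aux_i [IsLocalization (Submonoid.closure {X, f}) R] (hirr : Irreducible f)
    (hft : f ≠ X) (hft1 : f ≠ X + 1) (hrec : f.reverse ≠ f) (φ : R ≃+ R) (Φ : Rˣ ≃* Rˣ)
    (h : ∀ u : Rˣ, (Φ u : R) * φ 1 = φ u) (u : Rˣ) : Φ u = u := by
  obtain ⟨ψ, hs, hψ⟩ := aux_ring (f := f) φ Φ h
  have := aux_main hirr hft hft1 hrec ψ hs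
  ext
  rw [← hψ, this, RingHom.id_apply]

end


/-- Statement 13: let `f ∈ F₂[t]` be irreducible, different from `t` and `t+1`, and
not self-reciprocal, and let `R_f = F₂[t, t⁻¹, f(t)⁻¹]`.  Let `φ` be an automorphism
of `(R_f,+)` and `Φ` an automorphism of `U(R_f)`.  (i) If `Φ(u)·φ(1) = φ(u)` for all
units `u`, then `Φ = id`; (ii) if `Φ(u)·φ(1) = φ(u⁻¹)` for all units `u`, then
`Φ(u) = u⁻¹` for all units `u`. -/
theorem statement_13 (f : Polynomial (ZMod 2)) (hirr : Irreducible f)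
    (hft : f ≠ Polynomial.X) (hft1 : f ≠ Polynomial.X + 1)
    (hrec : f.reverse ≠ f)
    (φ : Localization (Submonoid.closure {Polynomial.X, f}) ≃+
      Localization (Submonoid.closure {Polynomial.X, f}))
    (Φ : (Localization (Submonoid.closure {Polynomial.X, f}))ˣ ≃*
      (Localization (Submonoid.closure {Polynomial.X, f}))ˣ) :
    ((∀ u : (Localization (Submonoid.closure {Polynomial.X, f}))ˣ,
        (Φ u : Localization (Submonoid.closure {Polynomial.X, f})) * φ 1 = φ u) →
      ∀ u, Φ u = u) ∧
    ((∀ u : (Localization (Submonoid.closure {Polynomial.X, f}))ˣ,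
        (Φ u : Localization (Submonoid.closure {Polynomial.X, f})) * φ 1 = φ (u⁻¹ : _ˣ)) →
      ∀ u, Φ u = u⁻¹) := by
  constructor
  · intro h u
    exact aux_i hirr hft hft1 hrec φ Φ h u
  · intro h u
    have := aux_i hirr hft hft1 hrec φ ((MulEquiv.inv _).trans Φ)
      (fun u => by simpa using h u⁻¹) u⁻¹
    simpa using this
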